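/- Campanato-type characterization for exponents p ∈ (0,1) (Lemma 6.2): Let p ∈ (0,1), R_0 ∈ (0,1/2), δ ∈ (0,1], and let u be a measurable function on B_1 ⊂ ℝ^d with ∫_K |u|^p dx < ∞ for every compact K ⊂ B_1. Suppose there is a constant M > 0 such that for every x_0 ∈ B_{1/2} and every r ∈ (0,R_0) there exists a constant c_{x_0,r} ∈ ℝ with (1/|B_r(x_0)|) ∫_{B_r(x_0)} |u − c_{x_0,r}|^p dx ≤ M^p r^{pδ}. Then there exist a constant N depending only on δ, p, R_0 and a function v : B_{1/2} → ℝ such that u = v almost everywhere in B_{1/2}, v is δ-Hölder continuous on B_{1/2}, and [v]_{δ;B_{1/2}} := sup_{x≠y∈B_{1/2}} |v(x) − v(y)|/|x − y|^δ ≤ N M. -/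

import Mathlib

open MeasureTheory Metric Set

lemma vol_ball (d : ℕ) (x : EuclideanSpace ℝ (Fin d)) {r : ℝ} (hr : 0 < r) :
    volume.real (ball x r) = r ^ d * volume.real (ball (0 : EuclideanSpace ℝ (Fin d)) 1) := by
  have := Measure.addHaar_ball_of_pos (volume : Measure (EuclideanSpace ℝ (Fin d))) x hr
  rw [measureReal_def, this, ENNReal.toReal_mul, ENNReal.toReal_ofReal (by positivity),
    finrank_euclideanSpace_fin, measureReal_def]

lemma good_ball (d : ℕ) (p R₀ δ : ℝ) (hp : p ∈ Ioo (0 : ℝ) 1) (hR : R₀ ∈ Ioo (0 : ℝ) (1/2))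
    (u : EuclideanSpace ℝ (Fin d) → ℝ) (M : ℝ) (hM : 0 < M) (hu : Measurable u)
    (hint : ∀ K : Set (EuclideanSpace ℝ (Fin d)),
          K ⊆ ball (0 : EuclideanSpace ℝ (Fin d)) 1 → IsCompact K →
          IntegrableOn (fun x => |u x| ^ p) K)
    (x₀ : EuclideanSpace ℝ (Fin d)) (hx : x₀ ∈ ball (0 : EuclideanSpace ℝ (Fin d)) (1/2))
    (r : ℝ) (hr : r ∈ Ioo (0 : ℝ) R₀) (c : ℝ)
    (hc : (∫ x in ball x₀ r, |u x - c| ^ p)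
            ≤ M ^ p * r ^ (p * δ) * (volume (ball x₀ r)).toReal) :
    volume.real (ball x₀ r ∩ {z | ((4 * 2 ^ d : ℝ) ^ (1 / p)) * M * r ^ δ < |u z - c|})
      ≤ volume.real (ball x₀ (r/2)) / 4 := by
  obtain ⟨hp0, hp1⟩ := hp
  obtain ⟨hr0, hr1⟩ := hr
  obtain ⟨hR0, hR1⟩ := hR
  have hsub : closedBall x₀ r ⊆ ball (0 : EuclideanSpace ℝ (Fin d)) 1 := by
    intro z hz
    simp only [mem_ball, mem_closedBall] at *
    linarith [dist_triangle z x₀ 0]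
  have hi : IntegrableOn (fun x => |u x| ^ p) (ball x₀ r) :=
    (hint _ hsub (isCompact_closedBall _ _)).mono_set ball_subset_closedBall
  have hci : IntegrableOn (fun _ => |c| ^ p) (ball x₀ r) :=
    integrableOn_const measure_ball_lt_top.ne
  have hi2 : IntegrableOn (fun x => |u x - c| ^ p) (ball x₀ r) := by
    refine (hi.add hci).mono' ((hu.sub_const c).abs.pow_const p).aestronglyMeasurable ?_
    refine Filter.Eventually.of_forall fun z => ?_
    simp only [Pi.add_apply]
    rw [Real.norm_of_nonneg (by positivity)]
    calc |u z - c| ^ p ≤ (|u z| + |c|) ^ p :=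
          Real.rpow_le_rpow (abs_nonneg _) (abs_sub _ _) hp0.le
      _ ≤ _ := Real.rpow_add_le_add_rpow (abs_nonneg _) (abs_nonneg _) hp0.le hp1.le
  set ε : ℝ := (4 * 2 ^ d : ℝ) * (M ^ p * r ^ (p * δ)) with hε
  have hεpos : 0 < ε := by positivity
  have hA : (((4 * 2 ^ d : ℝ) ^ (1 / p)) * M * r ^ δ) ^ p = ε := by
    rw [Real.mul_rpow (by positivity) (by positivity), Real.mul_rpow (by positivity) hM.le,
      ← Real.rpow_mul (by positivity), ← Real.rpow_mul hr0.le, hε, one_div,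
      inv_mul_cancel₀ hp0.ne', Real.rpow_one, mul_comm δ p, mul_assoc]
  have hch := mul_meas_ge_le_integral_of_nonneg (μ := volume.restrict (ball x₀ r))
    (f := fun x => |u x - c| ^ p) (Filter.Eventually.of_forall fun z => by positivity) hi2 ε
  have hmono : volume.real (ball x₀ r ∩ {z | ((4 * 2 ^ d : ℝ) ^ (1 / p)) * M * r ^ δ < |u z - c|})
     ≤ (volume.restrict (ball x₀ r)).real {x | ε ≤ |u x - c| ^ p} := by
    rw [measureReal_restrict_apply (measurableSet_le measurable_const (by fun_prop))]
    refine measureReal_mono ?_ (ne_top_of_le_ne_top measure_ball_lt_top.ne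
      (measure_mono inter_subset_right))
    rintro z ⟨hz, hz2⟩
    refine ⟨?_, hz⟩
    simp only [mem_ofPred_eq] at *
    rw [← hA]
    exact Real.rpow_le_rpow (by positivity) hz2.le hp0.le
  refine hmono.trans ?_
  have h2 := hch.trans hc
  rw [← measureReal_def] at h2
  rw [vol_ball d _ hr0] at h2
  rw [vol_ball d _ (half_pos hr0)]
  have h3 : 0 < M ^ p * r ^ (p * δ) := by positivity
  generalize (volume.restrict (ball x₀ r)).real {x | ε ≤ |u x - c| ^ p} = m at h2 ⊢
  rw [hε, mul_comm (4 * 2 ^ d : ℝ), mul_assoc] at h2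
  have h4 := le_of_mul_le_mul_left h2 h3
  rw [div_pow, le_div_iff₀ (by norm_num), div_mul_eq_mul_div, le_div_iff₀ (by positivity)]
  linarith

lemma exists_good {d : ℕ} (E B₁ B₂ : Set (EuclideanSpace ℝ (Fin d))) (w : ℝ)
    (hE : w ≤ volume.real E) (h1 : volume.real B₁ ≤ w / 4)
    (h2 : volume.real B₂ < 3 * w / 4) (f1 : volume B₁ ≠ ⊤) (f2 : volume B₂ ≠ ⊤) :
    ∃ z ∈ E, z ∉ B₁ ∧ z ∉ B₂ := by
  by_contra! h
  have : E ⊆ B₁ ∪ B₂ := by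
    intro z hz
    by_cases hb : z ∈ B₁
    · exact Or.inl hb
    · exact Or.inr (h z hz hb)
  have := measureReal_mono this (measure_union_ne_top f1 f2)
  have := measureReal_union_le (μ := volume) B₁ B₂
  linarith

lemma compare {d : ℕ} {R₀ δ B : ℝ} (hδ : 0 < δ) (hB : 0 < B)
    (u : EuclideanSpace ℝ (Fin d) → ℝ) (c : EuclideanSpace ℝ (Fin d) → ℝ → ℝ)
    (G : ∀ x ∈ ball (0 : EuclideanSpace ℝ (Fin d)) (1/2), ∀ r ∈ Ioo (0 : ℝ) R₀,
      volume.real (ball x r ∩ {z | B * r ^ δ < |u z - c x r|}) ≤ volume.real (ball x (r/2)) / 4)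
    (x y : EuclideanSpace ℝ (Fin d)) (hx : x ∈ ball (0 : EuclideanSpace ℝ (Fin d)) (1/2))
    (hy : y ∈ ball (0 : EuclideanSpace ℝ (Fin d)) (1/2)) (r s : ℝ) (hr : r ∈ Ioo (0 : ℝ) R₀)
    (hs1 : r / 2 ≤ s) (hs2 : s ≤ r) (hxy : dist x y ≤ r / 2) :
    |c x r - c y s| ≤ 2 * B * r ^ δ := by
  have hr0 := hr.1
  have hs0 : 0 < s := by linarith
  have g1 := G x hx r hr
  have g2 := G y hy s ⟨hs0, hs2.trans_lt hr.2⟩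
  have hw : 0 < volume.real (ball y (r/2)) :=
    ENNReal.toReal_pos (measure_ball_pos _ _ (half_pos hr0)).ne' measure_ball_lt_top.ne
  have e1 : volume.real (ball x (r/2)) = volume.real (ball y (r/2)) := by
    rw [vol_ball d _ (half_pos hr0), vol_ball d _ (half_pos hr0)]
  have e2 : volume.real (ball y (s/2)) ≤ volume.real (ball y (r/2)) :=
    measureReal_mono (ball_subset_ball (by linarith)) measure_ball_lt_top.ne
  obtain ⟨z, hz, h1, h2⟩ := exists_good (ball y (r/2)) _ _ _ le_rfl (g1.trans_eq (by rw [e1]))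
    (show volume.real (ball y s ∩ {z | B * s ^ δ < |u z - c y s|})
      < 3 * volume.real (ball y (r/2)) / 4 by linarith)
    (ne_top_of_le_ne_top measure_ball_lt_top.ne (measure_mono inter_subset_left))
    (ne_top_of_le_ne_top measure_ball_lt_top.ne (measure_mono inter_subset_left))
  have hzx : z ∈ ball x r := by
    rw [mem_ball] at *
    rw [dist_comm] at hxy
    linarith [dist_triangle z y x]
  have hzy : z ∈ ball y s := ball_subset_ball hs1 hz
  have h1' : |u z - c x r| ≤ B * r ^ δ := by
    by_contra hh
    exact h1 ⟨hzx, not_le.1 hh⟩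
  have h2' : |u z - c y s| ≤ B * s ^ δ := by
    by_contra hh
    exact h2 ⟨hzy, not_le.1 hh⟩
  have h3 : s ^ δ ≤ r ^ δ := Real.rpow_le_rpow hs0.le hs2 hδ.le
  have h4 := mul_le_mul_of_nonneg_left h3 hB.le
  rw [abs_le] at *
  constructor <;> linarith [h1'.1, h1'.2, h2'.1, h2'.2]

lemma rho_rpow {R₀ δ : ℝ} (hR : 0 < R₀) (k : ℕ) :
    (R₀ / 2 * (1/2) ^ k) ^ δ = (R₀ / 2) ^ δ * ((1/2 : ℝ) ^ δ) ^ k := by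
  rw [Real.mul_rpow (by positivity) (by positivity), ← Real.rpow_natCast, ← Real.rpow_mul (by norm_num),
    ← Real.rpow_natCast, ← Real.rpow_mul (by norm_num), mul_comm δ]

lemma rho_mem {R₀ : ℝ} (hR : 0 < R₀) (k : ℕ) : R₀ / 2 * (1/2) ^ k ∈ Ioo (0 : ℝ) R₀ := by
  refine ⟨by positivity, ?_⟩
  have : (1/2 : ℝ) ^ k ≤ 1 := pow_le_one₀ (by norm_num) (by norm_num)
  nlinarith

lemma exists_limit {d : ℕ} {R₀ δ B : ℝ} (hR : 0 < R₀) (hδ : 0 < δ) (hB : 0 < B)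
    (u : EuclideanSpace ℝ (Fin d) → ℝ) (c : EuclideanSpace ℝ (Fin d) → ℝ → ℝ)
    (G : ∀ x ∈ ball (0 : EuclideanSpace ℝ (Fin d)) (1/2), ∀ r ∈ Ioo (0 : ℝ) R₀,
      volume.real (ball x r ∩ {z | B * r ^ δ < |u z - c x r|}) ≤ volume.real (ball x (r/2)) / 4)
    (x : EuclideanSpace ℝ (Fin d)) (hx : x ∈ ball (0 : EuclideanSpace ℝ (Fin d)) (1/2)) :
    ∃ v : ℝ, ∀ k : ℕ, |c x (R₀ / 2 * (1/2) ^ k) - v|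
      ≤ 2 * B * (R₀ / 2 * (1/2) ^ k) ^ δ / (1 - (1/2 : ℝ) ^ δ) := by
  have hq : (1/2 : ℝ) ^ δ < 1 := Real.rpow_lt_one (by norm_num) (by norm_num) hδ
  have hstep : ∀ k : ℕ, dist (c x (R₀ / 2 * (1/2) ^ k)) (c x (R₀ / 2 * (1/2) ^ (k+1)))
      ≤ (2 * B * (R₀ / 2) ^ δ) * ((1/2 : ℝ) ^ δ) ^ k := by
    intro k
    have hk := rho_mem hR k
    have := compare hδ hB u c G x x hx hx _ (R₀ / 2 * (1/2) ^ (k+1)) hk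
      (by rw [pow_succ]; linarith) (by rw [pow_succ]; linarith [hk.1])
      (by rw [dist_self]; linarith [hk.1])
    rw [Real.dist_eq]
    rw [rho_rpow hR] at this
    linarith
  obtain ⟨v, hv⟩ := cauchySeq_tendsto_of_complete
    (cauchySeq_of_le_geometric _ _ hq hstep)
  refine ⟨v, fun k => ?_⟩
  have := dist_le_of_le_geometric_of_tendsto _ _ hq hstep hv k
  rw [Real.dist_eq] at this
  rw [rho_rpow hR, ← mul_assoc]
  exact this

lemma local_holder {d : ℕ} {R₀ δ B : ℝ} (hR : 0 < R₀) (hδ : 0 < δ) (hB : 0 < B)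
    (u : EuclideanSpace ℝ (Fin d) → ℝ) (c : EuclideanSpace ℝ (Fin d) → ℝ → ℝ)
    (G : ∀ x ∈ ball (0 : EuclideanSpace ℝ (Fin d)) (1/2), ∀ r ∈ Ioo (0 : ℝ) R₀,
      volume.real (ball x r ∩ {z | B * r ^ δ < |u z - c x r|}) ≤ volume.real (ball x (r/2)) / 4)
    (v : EuclideanSpace ℝ (Fin d) → ℝ)
    (hv : ∀ x ∈ ball (0 : EuclideanSpace ℝ (Fin d)) (1/2), ∀ k : ℕ,
      |c x (R₀ / 2 * (1/2) ^ k) - v x|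
      ≤ 2 * B * (R₀ / 2 * (1/2) ^ k) ^ δ / (1 - (1/2 : ℝ) ^ δ))
    (x y : EuclideanSpace ℝ (Fin d)) (hx : x ∈ ball (0 : EuclideanSpace ℝ (Fin d)) (1/2))
    (hy : y ∈ ball (0 : EuclideanSpace ℝ (Fin d)) (1/2)) (hxy : dist x y ≤ R₀ / 4) :
    |v x - v y| ≤ (4 / (1 - (1/2 : ℝ) ^ δ) + 2) * 4 ^ δ * B * dist x y ^ δ := by
  have hq : (1/2 : ℝ) ^ δ < 1 := Real.rpow_lt_one (by norm_num) (by norm_num) hδ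
  have hq' : 0 < 1 - (1/2 : ℝ) ^ δ := by linarith
  rcases eq_or_ne x y with rfl | hne
  · simp [Real.zero_rpow hδ.ne']
  have ht : 0 < dist x y := dist_pos.2 hne
  obtain ⟨n, hn1, hn2⟩ := exists_nat_pow_near_of_lt_one (x := 4 * dist x y / R₀) (y := (1/2 : ℝ))
    (by positivity) (by rw [div_le_one hR]; linarith) (by norm_num) (by norm_num)
  rw [lt_div_iff₀ hR, pow_succ] at hn1
  rw [div_le_iff₀ hR] at hn2
  have h1 := compare hδ hB u c G x y hx hy _ _ (rho_mem hR n) (by linarith [(rho_mem hR n).1]) le_rfl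
    (by linarith)
  have h2 := hv x hx n
  have h3 := hv y hy n
  have h4 : (R₀ / 2 * (1/2) ^ n) ^ δ ≤ 4 ^ δ * dist x y ^ δ := by
    rw [← Real.mul_rpow (by norm_num) ht.le]
    exact Real.rpow_le_rpow (rho_mem hR n).1.le (by linarith) hδ.le
  have h5 : |v x - v y| ≤ (4 / (1 - (1/2 : ℝ) ^ δ) + 2) * B * (R₀ / 2 * (1/2) ^ n) ^ δ := by
    have : (4 / (1 - (1/2 : ℝ) ^ δ) + 2) * B * (R₀ / 2 * (1/2) ^ n) ^ δ =
      2 * B * (R₀ / 2 * (1/2) ^ n) ^ δ / (1 - (1/2 : ℝ) ^ δ) +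
      2 * B * (R₀ / 2 * (1/2) ^ n) ^ δ / (1 - (1/2 : ℝ) ^ δ) + 2 * B * (R₀ / 2 * (1/2) ^ n) ^ δ := by
      ring
    rw [this]
    rw [abs_le] at *
    constructor <;> linarith [h1.1, h1.2, h2.1, h2.2, h3.1, h3.2]
  refine h5.trans ?_
  have := mul_le_mul_of_nonneg_left h4 (show 0 ≤ (4 / (1 - (1/2 : ℝ) ^ δ) + 2) * B by positivity)
  linarith

lemma chain {d : ℕ} {R₀ δ L : ℝ} (hR : 0 < R₀) (hδ : 0 < δ) (hL : 0 < L)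
    (v : EuclideanSpace ℝ (Fin d) → ℝ)
    (h : ∀ x ∈ ball (0 : EuclideanSpace ℝ (Fin d)) (1/2),
      ∀ y ∈ ball (0 : EuclideanSpace ℝ (Fin d)) (1/2), dist x y ≤ R₀ / 4 →
      |v x - v y| ≤ L * dist x y ^ δ)
    (x y : EuclideanSpace ℝ (Fin d)) (hx : x ∈ ball (0 : EuclideanSpace ℝ (Fin d)) (1/2))
    (hy : y ∈ ball (0 : EuclideanSpace ℝ (Fin d)) (1/2)) :
    |v x - v y| ≤ ⌈4 / R₀⌉₊ * L * dist x y ^ δ := by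
  set n := ⌈4 / R₀⌉₊ with hn
  have hn0 : 0 < n := Nat.ceil_pos.2 (by positivity)
  have hn0' : (1 : ℝ) ≤ n := by exact_mod_cast hn0
  have hnR : 4 / R₀ ≤ n := Nat.le_ceil _
  have hd : dist x y ≤ 1 := by
    rw [mem_ball] at hx hy
    linarith [dist_triangle_right x y 0]
  have hmem : ∀ i : ℕ, i ≤ n → AffineMap.lineMap x y ((i : ℝ) / n) ∈
      ball (0 : EuclideanSpace ℝ (Fin d)) (1/2) := by
    intro i hi
    refine (convex_ball _ _).lineMap_mem hx hy ⟨by positivity, ?_⟩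
    rw [div_le_one (by linarith)]
    exact_mod_cast hi
  have key : ∀ i : ℕ, i ≤ n →
      |v x - v (AffineMap.lineMap x y ((i : ℝ) / n))| ≤ i * (L * dist x y ^ δ) := by
    intro i
    induction i with
    | zero => intro _; simp
    | succ i ih =>
      intro hi
      have h1 := ih (by omega)
      have hdd : dist (AffineMap.lineMap x y ((i : ℝ) / n) : EuclideanSpace ℝ (Fin d))
          (AffineMap.lineMap x y (((i + 1 : ℕ) : ℝ) / n)) = dist x y / n := by
        rw [dist_lineMap_lineMap, Real.dist_eq, ← sub_div]
        push_cast
        rw [sub_add_cancel_left, abs_div, abs_neg, abs_one, abs_of_pos (by linarith : (0:ℝ) < n)]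
        ring
      have h2 := h _ (hmem i (by omega)) _ (hmem (i+1) hi) (by
        rw [hdd, div_le_iff₀ (by linarith)]
        rw [div_le_iff₀ hR] at hnR
        linarith)
      rw [hdd] at h2
      have h3 : (dist x y / n) ^ δ ≤ dist x y ^ δ :=
        Real.rpow_le_rpow (by positivity) (div_le_self dist_nonneg hn0') hδ.le
      have h4 := mul_le_mul_of_nonneg_left h3 hL.le
      have h5 := abs_sub_le (v x) (v (AffineMap.lineMap x y ((i : ℝ) / n)))
        (v (AffineMap.lineMap x y (((i + 1 : ℕ) : ℝ) / n)))
      push_cast at *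
      linarith
  have := key n le_rfl
  rw [div_self (by linarith), AffineMap.lineMap_apply_one] at this
  linarith

open Filter Topology in
lemma ae_bound {d : ℕ} {R₀ δ B : ℝ} (hR : 0 < R₀) (hδ : 0 < δ)
    (u : EuclideanSpace ℝ (Fin d) → ℝ) (c : EuclideanSpace ℝ (Fin d) → ℝ → ℝ)
    (G : ∀ x ∈ ball (0 : EuclideanSpace ℝ (Fin d)) (1/2), ∀ r ∈ Ioo (0 : ℝ) R₀,
      volume.real (ball x r ∩ {z | B * r ^ δ < |u z - c x r|}) ≤ volume.real (ball x (r/2)) / 4)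
    (v : EuclideanSpace ℝ (Fin d) → ℝ)
    (hv : ∀ x ∈ ball (0 : EuclideanSpace ℝ (Fin d)) (1/2), ∀ k : ℕ,
      |c x (R₀ / 2 * (1/2) ^ k) - v x|
      ≤ 2 * B * (R₀ / 2 * (1/2) ^ k) ^ δ / (1 - (1/2 : ℝ) ^ δ))
    (x : EuclideanSpace ℝ (Fin d)) (hx : x ∈ ball (0 : EuclideanSpace ℝ (Fin d)) (1/2))
    (S : Set (EuclideanSpace ℝ (Fin d)))
    (hdens : Tendsto (fun r => volume (S ∩ closedBall x r) / volume (closedBall x r))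
      (𝓝[>] 0) (𝓝 1)) (η : ℝ) (hη : 0 < η) : ∃ z ∈ S, |u z - v x| ≤ η := by
  have hρ : Tendsto (fun k : ℕ => R₀ / 2 * (1/2 : ℝ) ^ k) atTop (𝓝 0) := by
    simpa using (tendsto_pow_atTop_nhds_zero_of_lt_one (r := (1/2 : ℝ))
      (by norm_num) (by norm_num)).const_mul (R₀ / 2)
  have hρ2 : Tendsto (fun k : ℕ => R₀ / 2 * (1/2 : ℝ) ^ k / 2) atTop (𝓝[>] 0) := by
    refine tendsto_nhdsWithin_iff.2 ⟨by simpa using hρ.div_const 2, ?_⟩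
    exact Eventually.of_forall fun k => half_pos (rho_mem hR k).1
  have hρδ : Tendsto (fun k : ℕ => (R₀ / 2 * (1/2 : ℝ) ^ k) ^ δ) atTop (𝓝 0) := by
    have := hρ.rpow_const (p := δ) (Or.inr hδ.le)
    rwa [Real.zero_rpow hδ.ne'] at this
  have hlim : Tendsto (fun k : ℕ => B * (R₀ / 2 * (1/2 : ℝ) ^ k) ^ δ +
      2 * B * (R₀ / 2 * (1/2) ^ k) ^ δ / (1 - (1/2 : ℝ) ^ δ)) atTop (𝓝 0) := by
    simpa using (hρδ.const_mul B).add ((hρδ.const_mul (2 * B)).div_const (1 - (1/2 : ℝ) ^ δ))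
  have ev1 := hlim.eventually (gt_mem_nhds hη)
  have ev2 := (hdens.comp hρ2).eventually (lt_mem_nhds (show (1/2 : ENNReal) < 1 by
    rw [one_div]; exact ENNReal.one_half_lt_one))
  obtain ⟨k, hk1, hk2⟩ := (ev1.and ev2).exists
  set r := R₀ / 2 * (1/2 : ℝ) ^ k with hr
  have hrm : r ∈ Ioo (0 : ℝ) R₀ := rho_mem hR k
  have hr0 := hrm.1
  simp only [Function.comp_apply, ← hr] at hk2
  have hfin : volume (closedBall x (r/2)) ≠ ⊤ := measure_closedBall_lt_top.ne
  have hpos : 0 < volume (closedBall x (r/2)) := measure_closedBall_pos _ _ (half_pos hr0)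
  have hposr : 0 < volume.real (closedBall x (r/2)) := ENNReal.toReal_pos hpos.ne' hfin
  have hS2 : volume.real (closedBall x (r/2)) / 2 < volume.real (S ∩ closedBall x (r/2)) := by
    have := (ENNReal.toReal_lt_toReal (by simp)
      (ENNReal.div_ne_top (ne_top_of_le_ne_top hfin (measure_mono inter_subset_right)) hpos.ne')).2 hk2
    rw [ENNReal.toReal_div, ENNReal.toReal_div, ← measureReal_def, ← measureReal_def, lt_div_iff₀ hposr] at this
    simp at this
    linarith
  have hle : volume.real (ball x (r/2)) ≤ volume.real (closedBall x (r/2)) :=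
    measureReal_mono ball_subset_closedBall hfin
  have g := G x hx r hrm
  obtain ⟨z, hz, -, hzb⟩ := exists_good (S ∩ closedBall x (r/2)) ∅
    (ball x r ∩ {z | B * r ^ δ < |u z - c x r|}) _ le_rfl (by simp; positivity)
    (by linarith) (by simp)
    (ne_top_of_le_ne_top measure_ball_lt_top.ne (measure_mono inter_subset_left))
  refine ⟨z, hz.1, ?_⟩
  have hzx : z ∈ ball x r := closedBall_subset_ball (by linarith) hz.2
  have h1' : |u z - c x r| ≤ B * r ^ δ := by
    by_contra hh
    exact hzb ⟨hzx, not_le.1 hh⟩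
  have := abs_sub_le (u z) (c x r) (v x)
  have := hv x hx k
  rw [← hr] at this
  linarith

/-- **Lemma 6.2**: Campanato-type characterization of Hölder continuity with integral
exponents `p ∈ (0,1)`. -/
theorem campanato_small_exponent
    (d : ℕ) (p R₀ δ : ℝ) (hp : p ∈ Ioo (0 : ℝ) 1) (hR : R₀ ∈ Ioo (0 : ℝ) (1/2))
    (hδ : δ ∈ Ioc (0 : ℝ) 1) :
    ∃ N : ℝ, 0 < N ∧
      ∀ (u : EuclideanSpace ℝ (Fin d) → ℝ) (M : ℝ), 0 < M →
        Measurable u →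
        (∀ K : Set (EuclideanSpace ℝ (Fin d)),
          K ⊆ ball (0 : EuclideanSpace ℝ (Fin d)) 1 → IsCompact K →
          IntegrableOn (fun x => |u x| ^ p) K) →
        (∀ x₀ ∈ ball (0 : EuclideanSpace ℝ (Fin d)) (1/2), ∀ r ∈ Ioo (0 : ℝ) R₀,
          ∃ c : ℝ, (∫ x in ball x₀ r, |u x - c| ^ p)
            ≤ M ^ p * r ^ (p * δ) * (volume (ball x₀ r)).toReal) →
        ∃ v : EuclideanSpace ℝ (Fin d) → ℝ,
          (∀ᵐ x ∂(volume.restrict (ball (0 : EuclideanSpace ℝ (Fin d)) (1/2))),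
            u x = v x) ∧
          ∀ x ∈ ball (0 : EuclideanSpace ℝ (Fin d)) (1/2),
            ∀ y ∈ ball (0 : EuclideanSpace ℝ (Fin d)) (1/2),
              |v x - v y| ≤ N * M * dist x y ^ δ := by
  have hR0 := hR.1
  have hδ0 := hδ.1
  have hq : (1/2 : ℝ) ^ δ < 1 := Real.rpow_lt_one (by norm_num) (by norm_num) hδ0
  have hq' : 0 < 1 - (1/2 : ℝ) ^ δ := by linarith
  have hn0 : 0 < ⌈4 / R₀⌉₊ := Nat.ceil_pos.2 (by positivity)
  refine ⟨⌈4 / R₀⌉₊ * ((4 / (1 - (1/2 : ℝ) ^ δ) + 2) * 4 ^ δ * (4 * 2 ^ d : ℝ) ^ (1 / p)),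
    by positivity, ?_⟩
  intro u M hM hu hint hosc
  have hosc' : ∀ (x₀ : EuclideanSpace ℝ (Fin d)) (r : ℝ), ∃ c : ℝ,
      x₀ ∈ ball (0 : EuclideanSpace ℝ (Fin d)) (1/2) → r ∈ Ioo (0 : ℝ) R₀ →
      (∫ x in ball x₀ r, |u x - c| ^ p)
            ≤ M ^ p * r ^ (p * δ) * (volume (ball x₀ r)).toReal := by
    intro x₀ r
    by_cases h : x₀ ∈ ball (0 : EuclideanSpace ℝ (Fin d)) (1/2) ∧ r ∈ Ioo (0 : ℝ) R₀
    · obtain ⟨c, hc⟩ := hosc x₀ h.1 r h.2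
      exact ⟨c, fun _ _ => hc⟩
    · exact ⟨0, fun h1 h2 => absurd ⟨h1, h2⟩ h⟩
  choose c hc using hosc'
  set B : ℝ := (4 * 2 ^ d : ℝ) ^ (1 / p) * M with hBdef
  have hB : 0 < B := by positivity
  have G : ∀ x ∈ ball (0 : EuclideanSpace ℝ (Fin d)) (1/2), ∀ r ∈ Ioo (0 : ℝ) R₀,
      volume.real (ball x r ∩ {z | B * r ^ δ < |u z - c x r|})
        ≤ volume.real (ball x (r/2)) / 4 := fun x hx r hr =>
    good_ball d p R₀ δ hp hR u M hM hu hint x hx r hr (c x r) (hc x r hx hr)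
  have hv' : ∀ x : EuclideanSpace ℝ (Fin d), ∃ v : ℝ,
      x ∈ ball (0 : EuclideanSpace ℝ (Fin d)) (1/2) → ∀ k : ℕ,
      |c x (R₀ / 2 * (1/2) ^ k) - v|
      ≤ 2 * B * (R₀ / 2 * (1/2) ^ k) ^ δ / (1 - (1/2 : ℝ) ^ δ) := by
    intro x
    by_cases h : x ∈ ball (0 : EuclideanSpace ℝ (Fin d)) (1/2)
    · obtain ⟨v, hv⟩ := exists_limit hR0 hδ0 hB u c G x h
      exact ⟨v, fun _ => hv⟩
    · exact ⟨0, fun h1 => absurd h1 h⟩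
  choose v hv using hv'
  refine ⟨v, ?_, ?_⟩
  · have d1 : ∀ q : ℚ, ∀ᵐ x ∂(volume : Measure (EuclideanSpace ℝ (Fin d))),
        u x < q → ∀ η > 0, x ∈ ball (0 : EuclideanSpace ℝ (Fin d)) (1/2) →
          ∃ z ∈ {z | u z < q}, |u z - v x| ≤ η := by
      intro q
      have := Besicovitch.ae_tendsto_measure_inter_div
        (volume : Measure (EuclideanSpace ℝ (Fin d))) {z | u z < q}
      rw [ae_restrict_iff' (measurableSet_lt hu measurable_const)] at this
      filter_upwards [this] with x hx hxq η hη hxb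
      exact ae_bound hR0 hδ0 u c G v hv x hxb _ (hx hxq) η hη
    have d2 : ∀ q : ℚ, ∀ᵐ x ∂(volume : Measure (EuclideanSpace ℝ (Fin d))),
        q < u x → ∀ η > 0, x ∈ ball (0 : EuclideanSpace ℝ (Fin d)) (1/2) →
          ∃ z ∈ {z | q < u z}, |u z - v x| ≤ η := by
      intro q
      have := Besicovitch.ae_tendsto_measure_inter_div
        (volume : Measure (EuclideanSpace ℝ (Fin d))) {z | q < u z}
      rw [ae_restrict_iff' (measurableSet_lt measurable_const hu)] at this
      filter_upwards [this] with x hx hxq η hη hxb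
      exact ae_bound hR0 hδ0 u c G v hv x hxb _ (hx hxq) η hη
    rw [ae_restrict_iff' measurableSet_ball]
    filter_upwards [ae_all_iff.2 d1, ae_all_iff.2 d2] with x h1 h2 hxb
    apply le_antisymm
    · by_contra! hlt
      obtain ⟨q, hq1, hq2⟩ := exists_rat_btwn hlt
      obtain ⟨z, hz, hz2⟩ := h2 q hq2 ((q - v x) / 2) (by linarith) hxb
      have hz' : (q : ℝ) < u z := hz
      linarith [(abs_le.1 hz2).2]
    · by_contra! hlt
      obtain ⟨q, hq1, hq2⟩ := exists_rat_btwn hlt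
      obtain ⟨z, hz, hz2⟩ := h1 q hq1 ((v x - q) / 2) (by linarith) hxb
      have hz' : u z < (q : ℝ) := hz
      linarith [(abs_le.1 hz2).1]
  · intro x hx y hy
    have := chain hR0 hδ0 (L := (4 / (1 - (1/2 : ℝ) ^ δ) + 2) * 4 ^ δ * B) (by positivity) v
      (fun x hx y hy hxy => local_holder hR0 hδ0 hB u c G v hv x y hx hy hxy) x y hx hy
    refine this.trans_eq ?_
    rw [hBdef]
    ring
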